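/- Let n be a positive integer with n ≡ 1 (mod 4) and let a be an indeterminate. Then, modulo [n]_{q^2}·(1−aq^{2n})·(a−q^{2n}), the sum over k from 0 to (n−1)/4 of [8k+1]_{q^2} · [8k+1]^2 · (q^2;q^8)_k^2 (aq^2;q^8)_k (q^2/a;q^8)_k / ((q^8;q^8)_k^2 (aq^8;q^8)_k (q^8/a;q^8)_k) · q^{−4k} is congruent to [n]_{q^2} · ((q^4;q^8)_{(n−1)/4}/(q^8;q^8)_{(n−1)/4}) · q^{−(n−1)/2} · (1 − (1−aq^2)(1−q^2/a) / ((1−q)^2 (1+q^2))). -/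

import Mathlib

open Polynomial Finset

/-- The q-shifted factorial `(x; r)_k = (1-x)(1-x r)⋯(1-x r^(k-1))`. -/
noncomputable def qPoch {F : Type*} [Field F] (x r : F) (k : ℕ) : F :=
  ∏ i ∈ Finset.range k, (1 - x * r ^ i)

/-- The q-integer `[z] = (1-q^z)/(1-q)` (for an arbitrary integer `z`). -/
noncomputable def qInt {F : Type*} [Field F] (q : F) (z : ℤ) : F :=
  (1 - q ^ z) / (1 - q)

/-- The rational function `x ∈ ℚ(a)(q)` is ≡ 0 modulo the polynomial `M ∈ ℚ(a)[q]`: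
its numerator in lowest terms is divisible by `M`, i.e. `x = M·f/g` with `g` coprime to `M`.
Here the coefficient field `RatFunc ℚ` is the field of rational functions in `a`. -/
def ratCongr2 (M : Polynomial (RatFunc ℚ)) (x : RatFunc (RatFunc ℚ)) : Prop :=
  ∃ f g : Polynomial (RatFunc ℚ), IsCoprime M g ∧
    x * algebraMap (Polynomial (RatFunc ℚ)) (RatFunc (RatFunc ℚ)) g =
      algebraMap (Polynomial (RatFunc ℚ)) (RatFunc (RatFunc ℚ)) M *
        algebraMap (Polynomial (RatFunc ℚ)) (RatFunc (RatFunc ℚ)) f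


section Field

variable {K : Type*} [Field K]

lemma qPoch_zero (x r : K) : qPoch x r 0 = 1 := by simp [qPoch]

lemma qPoch_succ (x r : K) (k : ℕ) : qPoch x r (k + 1) = qPoch x r k * (1 - x * r ^ k) := by
  simp [qPoch, prod_range_succ]

lemma qPoch_succ' (x r : K) (k : ℕ) : qPoch x r (k + 1) = (1 - x) * qPoch (x * r) r k := by
  simp [qPoch, prod_range_succ', pow_succ', mul_assoc, mul_comm]

lemma qPoch_ne_zero {x r : K} {k : ℕ} (h : ∀ i < k, 1 - x * r ^ i ≠ 0) : qPoch x r k ≠ 0 :=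
  prod_ne_zero_iff.2 fun i hi => h i (mem_range.1 hi)

lemma qPoch_eq_zero {x r : K} {k i : ℕ} (hi : i < k) (h : 1 - x * r ^ i = 0) :
    qPoch x r k = 0 :=
  prod_eq_zero (mem_range.2 hi) h

/-- The summand of a well-poised `₆φ₅` series, without its very-well-poised part. -/
noncomputable def wellPoised (A d e f r : K) (k : ℕ) : K :=
  qPoch A r k * qPoch d r k * qPoch e r k * qPoch f r k /
    (qPoch r r k * qPoch (A * r / d) r k * qPoch (A * r / e) r k * qPoch (A * r / f) r k) *
      (A * r / (d * e * f)) ^ k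

lemma wellPoised_succ (A d e f r : K) (k : ℕ) :
    wellPoised A d e f r (k + 1) = wellPoised A d e f r k *
      ((1 - A * r ^ k) * (1 - d * r ^ k) * (1 - e * r ^ k) * (1 - f * r ^ k) /
        ((1 - r * r ^ k) * (1 - A * r / d * r ^ k) * (1 - A * r / e * r ^ k) *
          (1 - A * r / f * r ^ k)) * (A * r / (d * e * f))) := by
  simp only [wellPoised, qPoch_succ, pow_succ, div_eq_mul_inv, mul_inv]
  ring

/-- A contiguous relation for partial sums of a very-well-poised `₆φ₅` series. -/
lemma sum_wellPoised_contiguous {A d e f r : K} (hd : d ≠ 0) (he : e ≠ 0) (hf : f ≠ 0)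
    (hr : r ≠ 0) (h1 : ∀ i, 1 - r * r ^ i ≠ 0) (h2 : ∀ i, 1 - A * r / d * r ^ i ≠ 0)
    (h3 : ∀ i, 1 - A * r / e * r ^ i ≠ 0) (h4 : ∀ i, 1 - A * r / f * r ^ i ≠ 0) (m : ℕ) :
    (A - d * e * f) * ∑ k ∈ range m, (1 - r ^ k) * (1 - A * r ^ k) / r ^ k *
        ((1 - A * r ^ (2 * k)) * wellPoised A d e f r k) =
      -A * (1 - d) * (1 - e) * (1 - f) *
        ∑ k ∈ range m, (1 - A * r ^ (2 * k)) * wellPoised A d e f r k +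
      d * e * f * ((1 - r ^ m) * (1 - A * r ^ m / d) * (1 - A * r ^ m / e) *
        (1 - A * r ^ m / f)) / r ^ m * wellPoised A d e f r m := by
  induction m with
  | zero => simp
  | succ m ih =>
    rw [sum_range_succ, sum_range_succ, mul_add, mul_add, ih, wellPoised_succ]
    have hY : r ^ m ≠ 0 := pow_ne_zero _ hr
    have e1 := h1 m
    have e2 := h2 m
    have e3 := h3 m
    have e4 := h4 m
    have e5 : r ^ (m + 1) = r * r ^ m := pow_succ' _ _
    have e6 : r ^ (2 * m) = (r ^ m) ^ 2 := by rw [mul_comm, pow_mul]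
    rw [e5, e6]
    generalize r ^ m = Y at *
    generalize wellPoised A d e f r m = τ
    have key : d * e * f * ((1 - r * Y) * (1 - A * (r * Y) / d) * (1 - A * (r * Y) / e) *
        (1 - A * (r * Y) / f)) / (r * Y) * (τ * ((1 - A * Y) * (1 - d * Y) * (1 - e * Y) *
        (1 - f * Y) / ((1 - r * Y) * (1 - A * r / d * Y) * (1 - A * r / e * Y) *
          (1 - A * r / f * Y)) * (A * r / (d * e * f)))) =
        A * ((1 - A * Y) * (1 - d * Y) * (1 - e * Y) * (1 - f * Y)) / Y * τ := by
      rw [show A * (r * Y) / d = A * r / d * Y by ring,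
        show A * (r * Y) / e = A * r / e * Y by ring,
        show A * (r * Y) / f = A * r / f * Y by ring]
      generalize 1 - A * r / d * Y = u2 at *
      generalize 1 - A * r / e * Y = u3 at *
      generalize 1 - A * r / f * Y = u4 at *
      generalize 1 - r * Y = u1 at *
      field_simp
    rw [key]
    field_simp
    ring

lemma wellPoised_shift {A d e r : K} (hd : d ≠ 0) (he : e ≠ 0) (hr : r ≠ 0)
    (h4 : ∀ i, 1 - A * r * r ^ i ≠ 0) (N k : ℕ) :
    (1 - (r ^ (N + 1))⁻¹) * (1 - A * r ^ (N + 1)) * wellPoised A d e (r ^ N)⁻¹ r k =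
      ((1 - r ^ k) * (1 - A * r ^ k) / r ^ k +
        (1 - (r ^ (N + 1))⁻¹) * (1 - A * r ^ (N + 1))) *
        wellPoised A d e (r ^ (N + 1))⁻¹ r k := by
  have hR : r ^ (N + 1) ≠ 0 := pow_ne_zero _ hr
  have h4' : ∀ i, 1 - A * r / (r ^ (N + 1))⁻¹ * r ^ i ≠ 0 := by
    intro i
    convert h4 (N + 1 + i) using 1
    field_simp
    ring
  have hY : r ^ k ≠ 0 := pow_ne_zero _ hr
  have a1 : (1 - (r ^ (N + 1))⁻¹) * qPoch (r ^ N)⁻¹ r k =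
      (1 - (r ^ (N + 1))⁻¹ * r ^ k) * qPoch (r ^ (N + 1))⁻¹ r k := by
    have := qPoch_succ' (r ^ (N + 1))⁻¹ r k
    rw [qPoch_succ, show (r ^ (N + 1))⁻¹ * r = (r ^ N)⁻¹ by field_simp; ring] at this
    rw [← this]; ring
  have a2 : (1 - A * r ^ (N + 1)) * qPoch (A * r / (r ^ (N + 1))⁻¹) r k =
      (1 - A * r ^ (N + 1) * r ^ k) * qPoch (A * r / (r ^ N)⁻¹) r k := by
    have := qPoch_succ' (A * r ^ (N + 1)) r k
    rw [qPoch_succ] at this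
    rw [show A * r / (r ^ (N + 1))⁻¹ = A * r ^ (N + 1) * r by field_simp, ← this,
      show A * r / (r ^ N)⁻¹ = A * r ^ (N + 1) by field_simp; ring]
    ring
  have b1 : qPoch (A * r / (r ^ N)⁻¹) r k ≠ 0 := by
    refine qPoch_ne_zero fun i _ => ?_
    convert h4 (N + i) using 1
    field_simp
    ring
  have b2 : qPoch (A * r / (r ^ (N + 1))⁻¹) r k ≠ 0 := qPoch_ne_zero fun i _ => h4' i
  have a3 : (A * r / (d * e * (r ^ (N + 1))⁻¹)) ^ k =
      (A * r / (d * e * (r ^ N)⁻¹)) ^ k * r ^ k := by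
    rw [← mul_pow]; congr 1; field_simp; ring
  have a4 : (1 - r ^ k) * (1 - A * r ^ k) / r ^ k +
      (1 - (r ^ (N + 1))⁻¹) * (1 - A * r ^ (N + 1)) =
      (1 - (r ^ (N + 1))⁻¹ * r ^ k) * (1 - A * r ^ (N + 1) * r ^ k) / r ^ k := by
    field_simp
    ring
  rw [a4]
  simp only [wellPoised]
  rw [a3]
  have c1 : (1 - A * r ^ (N + 1)) / qPoch (A * r / (r ^ N)⁻¹) r k =
      (1 - A * r ^ (N + 1) * r ^ k) / qPoch (A * r / (r ^ (N + 1))⁻¹) r k := by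
    rw [div_eq_div_iff b1 b2, a2]
  calc _ = ((1 - (r ^ (N + 1))⁻¹) * qPoch (r ^ N)⁻¹ r k) *
        ((1 - A * r ^ (N + 1)) / qPoch (A * r / (r ^ N)⁻¹) r k) *
        (qPoch A r k * qPoch d r k * qPoch e r k /
        (qPoch r r k * qPoch (A * r / d) r k * qPoch (A * r / e) r k)) *
        (A * r / (d * e * (r ^ N)⁻¹)) ^ k := by
          simp only [div_eq_mul_inv, mul_inv]; ring
    _ = _ := by
        rw [a1, c1, div_mul_eq_mul_div _ (r ^ k), eq_div_iff hY]
        generalize (A * r / (d * e * (r ^ N)⁻¹)) ^ k = z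
        generalize qPoch (A * r / (r ^ (N + 1))⁻¹) r k = x1
        generalize qPoch (r ^ (N + 1))⁻¹ r k = x2
        generalize (1 - (r ^ (N + 1))⁻¹ * r ^ k) = x3
        generalize (1 - A * r ^ (N + 1) * r ^ k) = x4
        simp only [div_eq_mul_inv, mul_inv]
        ring

/-- The terminating `₆φ₅` summation. -/
lemma sum_wellPoised_terminating {A d e r : K} (hd : d ≠ 0) (he : e ≠ 0)
    (hr : r ≠ 0) (h1 : ∀ i, 1 - r * r ^ i ≠ 0) (h2 : ∀ i, 1 - A * r / d * r ^ i ≠ 0)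
    (h3 : ∀ i, 1 - A * r / e * r ^ i ≠ 0) (h4 : ∀ i, 1 - A * r * r ^ i ≠ 0) (N : ℕ) :
    ∑ k ∈ range (N + 1), (1 - A * r ^ (2 * k)) * wellPoised A d e (r ^ N)⁻¹ r k =
      (1 - A) * ∏ i ∈ range N, ((1 - A * r / (d * e) * r ^ i) * (1 - A * r * r ^ i) /
        ((1 - A * r / d * r ^ i) * (1 - A * r / e * r ^ i))) := by
  induction N with
  | zero => simp [wellPoised, qPoch_zero]
  | succ N ih =>
    have hR : r ^ (N + 1) ≠ 0 := pow_ne_zero _ hr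
    have hf : (r ^ (N + 1))⁻¹ ≠ 0 := inv_ne_zero hR
    have h4' : ∀ i, 1 - A * r / (r ^ (N + 1))⁻¹ * r ^ i ≠ 0 := by
      intro i
      convert h4 (N + 1 + i) using 1
      field_simp
      ring
    have hc := sum_wellPoised_contiguous hd he hf hr h1 h2 h3 h4' (N + 2)
    have hz : wellPoised A d e (r ^ (N + 1))⁻¹ r (N + 2) = 0 := by
      have : qPoch (r ^ (N + 1))⁻¹ r (N + 2) = 0 :=
        qPoch_eq_zero (i := N + 1) (by omega) (by field_simp; simp)
      simp [wellPoised, this]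
    have hstep := wellPoised_shift hd he hr h4 N
    have hz' : wellPoised A d e (r ^ N)⁻¹ r (N + 1) = 0 := by
      have : qPoch (r ^ N)⁻¹ r (N + 1) = 0 :=
        qPoch_eq_zero (i := N) (by omega) (by field_simp; simp)
      simp [wellPoised, this]
    have hsum : (1 - (r ^ (N + 1))⁻¹) * (1 - A * r ^ (N + 1)) *
        ∑ k ∈ range (N + 1), (1 - A * r ^ (2 * k)) * wellPoised A d e (r ^ N)⁻¹ r k =
        ∑ k ∈ range (N + 2), (1 - r ^ k) * (1 - A * r ^ k) / r ^ k *
          ((1 - A * r ^ (2 * k)) * wellPoised A d e (r ^ (N + 1))⁻¹ r k) +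
        (1 - (r ^ (N + 1))⁻¹) * (1 - A * r ^ (N + 1)) *
        ∑ k ∈ range (N + 2), (1 - A * r ^ (2 * k)) * wellPoised A d e (r ^ (N + 1))⁻¹ r k := by
      have : ∑ k ∈ range (N + 1), (1 - A * r ^ (2 * k)) * wellPoised A d e (r ^ N)⁻¹ r k =
          ∑ k ∈ range (N + 2), (1 - A * r ^ (2 * k)) * wellPoised A d e (r ^ N)⁻¹ r k := by
        rw [sum_range_succ _ (N + 1), hz']; simp
      rw [this, mul_sum, mul_sum, ← sum_add_distrib]
      refine sum_congr rfl fun k _ => ?_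
      linear_combination (1 - A * r ^ (2 * k)) * hstep k
    rw [hz, mul_zero, add_zero] at hc
    rw [prod_range_succ, ← mul_assoc, ← ih]
    have e1 : r ^ (N + 1) - 1 ≠ 0 := by
      have := h1 N
      rw [← pow_succ'] at this
      exact fun h => this (by linear_combination -h)
    have e2 := h2 N
    have e3 := h3 N
    rw [show N + 1 + 1 = N + 2 from rfl]
    generalize ∑ k ∈ range (N + 2), (1 - r ^ k) * (1 - A * r ^ k) / r ^ k *
          ((1 - A * r ^ (2 * k)) * wellPoised A d e (r ^ (N + 1))⁻¹ r k) = S2 at *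
    generalize ∑ k ∈ range (N + 2), (1 - A * r ^ (2 * k)) *
      wellPoised A d e (r ^ (N + 1))⁻¹ r k = S1 at *
    generalize ∑ k ∈ range (N + 1), (1 - A * r ^ (2 * k)) * wellPoised A d e (r ^ N)⁻¹ r k =
      S0 at *
    have g1 : A * r / d * r ^ N = A * r ^ (N + 1) / d := by ring
    have g2 : A * r / e * r ^ N = A * r ^ (N + 1) / e := by ring
    have g3 : A * r / (d * e) * r ^ N = A * r ^ (N + 1) / (d * e) := by ring
    have g4 : A * r * r ^ N = A * r ^ (N + 1) := by ring
    rw [g1] at e2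
    rw [g2] at e3
    rw [g1, g2, g3, g4, mul_div_assoc', eq_div_iff (mul_ne_zero e2 e3)]
    generalize r ^ (N + 1) = R at *
    field_simp at hsum hc ⊢
    apply mul_left_cancel₀ e1
    linear_combination R * hc - (d * e - A * R) * hsum

end Field

section Summand

variable {K : Type*} [Field K]

/-- The summand of the truncated series. -/
noncomputable def summand (q a : K) (k : ℕ) : K :=
  qInt (q ^ 2) (8 * (k : ℤ) + 1) * qInt q (8 * (k : ℤ) + 1) ^ 2 *
    (qPoch (q ^ 2) (q ^ 8) k ^ 2 * qPoch (a * q ^ 2) (q ^ 8) k *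
      qPoch (q ^ 2 / a) (q ^ 8) k) /
    (qPoch (q ^ 8) (q ^ 8) k ^ 2 * qPoch (a * q ^ 8) (q ^ 8) k *
      qPoch (q ^ 8 / a) (q ^ 8) k) * q ^ (-4 * (k : ℤ))

/-- The claimed value of the truncated series. -/
noncomputable def closedForm (q a : K) (n : ℕ) : K :=
  qInt (q ^ 2) (n : ℤ) * qPoch (q ^ 4) (q ^ 8) ((n - 1) / 4) /
    qPoch (q ^ 8) (q ^ 8) ((n - 1) / 4) * q ^ (-(((n : ℤ) - 1) / 2)) *
      (1 - (1 - a * q ^ 2) * (1 - q ^ 2 / a) / ((1 - q) ^ 2 * (1 + q ^ 2)))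

lemma summand_inv (q a : K) (k : ℕ) : summand q a⁻¹ k = summand q a k := by
  simp only [summand, div_inv_eq_mul, inv_mul_eq_div, mul_comm _ a]
  ring

lemma closedForm_inv (q a : K) (n : ℕ) : closedForm q a⁻¹ n = closedForm q a n := by
  simp only [closedForm, div_inv_eq_mul, inv_mul_eq_div, mul_comm _ a]
  ring

lemma qInt_natCast (q : K) (m : ℕ) : qInt q (m : ℤ) = (1 - q ^ m) / (1 - q) := by
  simp [qInt]

lemma qInt_eight_mul_add_one (q : K) (k : ℕ) :
    qInt q (8 * (k : ℤ) + 1) = (1 - q ^ (8 * k + 1)) / (1 - q) := by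
  rw [← qInt_natCast]; push_cast; rfl

lemma summand_eq_wellPoised {q a : K} (hq : q ≠ 0) (ha : a ≠ 0) (k : ℕ) :
    summand q a k = ((1 - (q ^ 8) ^ k) * (1 - q ^ 2 * (q ^ 8) ^ k) / (q ^ 8) ^ k + (1 - q) ^ 2) *
      ((1 - q ^ 2 * (q ^ 8) ^ (2 * k)) *
        wellPoised (q ^ 2) (q ^ 2) (q ^ 2 / a) (a * q ^ 2) (q ^ 8) k) /
          ((1 - q ^ 2) * (1 - q) ^ 2) := by
  have hY : q ^ k ≠ 0 := pow_ne_zero _ hq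
  have h0 : (1 - (q ^ 8) ^ k) * (1 - q ^ 2 * (q ^ 8) ^ k) / (q ^ 8) ^ k + (1 - q) ^ 2 =
      (1 - q ^ (8 * k + 1)) ^ 2 / (q ^ 8) ^ k := by
    have : q ^ (8 * k + 1) = q * (q ^ 8) ^ k := by rw [pow_succ', pow_mul]
    rw [this]
    field_simp
    ring
  have h1 : q ^ 2 * q ^ 8 / q ^ 2 = q ^ 8 := by field_simp
  have h2 : q ^ 2 * q ^ 8 / (q ^ 2 / a) = a * q ^ 8 := by field_simp
  have h3 : q ^ 2 * q ^ 8 / (a * q ^ 2) = q ^ 8 / a := by field_simp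
  have h4 : q ^ 2 * q ^ 8 / (q ^ 2 * (q ^ 2 / a) * (a * q ^ 2)) = q ^ 4 := by field_simp
  have h5 : q ^ (-4 * (k : ℤ)) = (q ^ 4) ^ k / (q ^ 8) ^ k := by
    rw [eq_div_iff (by positivity), ← pow_mul, ← pow_mul, ← zpow_natCast, ← zpow_natCast,
      ← zpow_add₀ hq]
    congr 1; push_cast; ring
  rw [h0, wellPoised, h1, h2, h3, h4, summand, h5, qInt_eight_mul_add_one,
    qInt_eight_mul_add_one]
  rw [show q ^ 2 * (q ^ 8) ^ (2 * k) = (q ^ 2) ^ (8 * k + 1) by ring]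
  simp only [div_eq_mul_inv, mul_inv, ← inv_pow]
  ring

lemma sum_summand_eq_closedForm {q a : K} (hinj : Function.Injective fun m : ℕ => q ^ m)
    (hq : q ≠ 0) {n : ℕ} (hn4 : n % 4 = 1) (ha : a * q ^ (2 * n) = 1) :
    ∑ k ∈ range ((n - 1) / 4 + 1), summand q a k = closedForm q a n := by
  obtain ⟨N, rfl⟩ : ∃ N, n = 4 * N + 1 := ⟨n / 4, by omega⟩
  have hN : (4 * N + 1 - 1) / 4 = N := by omega
  have ha0 : a ≠ 0 := left_ne_zero_of_mul_eq_one ha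
  have hne : ∀ m, 0 < m → 1 - q ^ m ≠ 0 := fun m hm h =>
    hm.ne' (hinj (show q ^ m = q ^ 0 by rw [pow_zero]; linear_combination -h))
  have haeq : a = (q ^ (2 * (4 * N + 1)))⁻¹ := eq_inv_of_mul_eq_one_left ha
  have hf : a * q ^ 2 = ((q ^ 8) ^ N)⁻¹ := by
    rw [haeq]; field_simp; ring
  have hr : q ^ 8 ≠ 0 := pow_ne_zero _ hq
  have hA : q ^ 2 ≠ 0 := pow_ne_zero _ hq
  have he : q ^ 2 / a ≠ 0 := div_ne_zero hA ha0
  have h1 : ∀ i, 1 - q ^ 8 * (q ^ 8) ^ i ≠ 0 := fun i => by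
    rw [← pow_succ', ← pow_mul]; exact hne _ (by omega)
  have h2 : ∀ i, 1 - q ^ 2 * q ^ 8 / q ^ 2 * (q ^ 8) ^ i ≠ 0 := fun i => by
    rw [mul_div_cancel_left₀ _ hA]; exact h1 i
  have h3 : ∀ i, 1 - q ^ 2 * q ^ 8 / (q ^ 2 / a) * (q ^ 8) ^ i ≠ 0 := fun i h => by
    have : q ^ (2 * (4 * N + 1)) = q ^ (8 + 8 * i) := by
      apply mul_left_cancel₀ ha0
      rw [ha, pow_add, pow_mul]
      field_simp at h
      linear_combination h
    have := hinj this
    omega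
  have h4 : ∀ i, 1 - q ^ 2 * q ^ 8 * (q ^ 8) ^ i ≠ 0 := fun i => by
    rw [← pow_mul, ← pow_add, ← pow_add]; exact hne _ (by omega)
  have h4' : ∀ i, 1 - q ^ 2 * q ^ 8 / (a * q ^ 2) * (q ^ 8) ^ i ≠ 0 := fun i => by
    rw [hf]
    convert h4 (N + i) using 1
    field_simp
    ring
  have hc := sum_wellPoised_contiguous hA he (mul_ne_zero ha0 hA) hr h1 h2 h3 h4' (N + 1)
  have hz : wellPoised (q ^ 2) (q ^ 2) (q ^ 2 / a) (a * q ^ 2) (q ^ 8) (N + 1) = 0 := by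
    have : qPoch (a * q ^ 2) (q ^ 8) (N + 1) = 0 :=
      qPoch_eq_zero (i := N) (by omega) (by rw [hf]; field_simp; simp)
    simp [wellPoised, this]
  have ht := sum_wellPoised_terminating hA he hr h1 h2 h3 h4 N
  rw [← hf] at ht
  have hprod : (1 - q ^ 2) * ∏ i ∈ range N, ((1 - q ^ 2 * q ^ 8 / (q ^ 2 * (q ^ 2 / a)) *
      (q ^ 8) ^ i) * (1 - q ^ 2 * q ^ 8 * (q ^ 8) ^ i) /
        ((1 - q ^ 2 * q ^ 8 / q ^ 2 * (q ^ 8) ^ i) *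
          (1 - q ^ 2 * q ^ 8 / (q ^ 2 / a) * (q ^ 8) ^ i))) =
      (1 - q ^ (2 * (4 * N + 1))) * (qPoch (q ^ 4) (q ^ 8) N / qPoch (q ^ 8) (q ^ 8) N *
        ((q ^ 2) ^ N)⁻¹) := by
    have p1 : (1 - q ^ 2) * ∏ i ∈ range N, (1 - q ^ 2 * q ^ 8 * (q ^ 8) ^ i) =
        qPoch (q ^ 2) (q ^ 8) N * (1 - q ^ (2 * (4 * N + 1))) := by
      have := qPoch_succ' (q ^ 2) (q ^ 8) N
      rw [qPoch_succ] at this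
      rw [show (1 - q ^ (2 * (4 * N + 1))) = (1 - q ^ 2 * (q ^ 8) ^ N) by ring, this]
      rfl
    have p2 : ∏ i ∈ range N, ((1 - q ^ 2 * q ^ 8 / (q ^ 2 * (q ^ 2 / a)) * (q ^ 8) ^ i) /
        (1 - q ^ 2 * q ^ 8 / (q ^ 2 / a) * (q ^ 8) ^ i)) =
        qPoch (q ^ 4) (q ^ 8) N / qPoch (q ^ 2) (q ^ 8) N * ((q ^ 2) ^ N)⁻¹ := by
      rw [← prod_range_reflect, qPoch, qPoch, ← prod_div_distrib, ← inv_pow,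
        ← card_range N, ← prod_const, card_range, ← prod_mul_distrib]
      refine prod_congr rfl fun i hi => ?_
      obtain ⟨j, rfl⟩ : ∃ j, N = i + 1 + j := ⟨N - (i + 1), by
        have := mem_range.1 hi; omega⟩
      have e2 : 1 - q ^ 2 * (q ^ 8) ^ i ≠ 0 := by
        rw [← pow_mul, ← pow_add]; exact hne _ (by omega)
      have e1 := h3 (i + 1 + j - 1 - i)
      rw [show i + 1 + j - 1 - i = j by omega] at e1 ⊢
      rw [← div_eq_mul_inv, div_div, div_eq_div_iff e1 (mul_ne_zero e2 hA), haeq]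
      field_simp
      ring
    have e0 : qPoch (q ^ 2) (q ^ 8) N ≠ 0 := qPoch_ne_zero fun i _ => by
      rw [← pow_mul, ← pow_add]; exact hne _ (by omega)
    calc _ = ((1 - q ^ 2) * ∏ i ∈ range N, (1 - q ^ 2 * q ^ 8 * (q ^ 8) ^ i)) *
          (∏ i ∈ range N, ((1 - q ^ 2 * q ^ 8 / (q ^ 2 * (q ^ 2 / a)) * (q ^ 8) ^ i) /
            (1 - q ^ 2 * q ^ 8 / (q ^ 2 / a) * (q ^ 8) ^ i))) / qPoch (q ^ 8) (q ^ 8) N := by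
          simp only [mul_div_cancel_left₀ _ hA, prod_mul_distrib, prod_div_distrib, qPoch]
          simp only [div_eq_mul_inv, mul_inv]
          ring
      _ = _ := by
          rw [p1, p2]
          generalize qPoch (q ^ 8) (q ^ 8) N = x
          simp only [div_eq_mul_inv]
          field_simp
  rw [hprod] at ht
  rw [hz, mul_zero, add_zero, ht] at hc
  have hsum : ∑ k ∈ range (N + 1), summand q a k =
      (∑ k ∈ range (N + 1), (1 - (q ^ 8) ^ k) * (1 - q ^ 2 * (q ^ 8) ^ k) / (q ^ 8) ^ k *
        ((1 - q ^ 2 * (q ^ 8) ^ (2 * k)) *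
          wellPoised (q ^ 2) (q ^ 2) (q ^ 2 / a) (a * q ^ 2) (q ^ 8) k) + (1 - q) ^ 2 *
      ∑ k ∈ range (N + 1), (1 - q ^ 2 * (q ^ 8) ^ (2 * k)) *
        wellPoised (q ^ 2) (q ^ 2) (q ^ 2 / a) (a * q ^ 2) (q ^ 8) k) /
          ((1 - q ^ 2) * (1 - q) ^ 2) := by
    rw [mul_sum, ← sum_add_distrib, sum_div]
    refine sum_congr rfl fun k _ => ?_
    rw [summand_eq_wellPoised hq ha0]
    ring
  have hz2 : q ^ (-(((4 * N + 1 : ℕ) : ℤ) - 1) / 2) = ((q ^ 2) ^ N)⁻¹ := by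
    rw [← pow_mul, ← zpow_natCast, ← zpow_neg]
    congr 1; push_cast; omega
  have hz3 : -((((4 * N + 1 : ℕ) : ℤ) - 1) / 2) = -(((4 * N + 1 : ℕ) : ℤ) - 1) / 2 := by
    omega
  rw [hN, hsum, ht, closedForm, hN, hz3, hz2, qInt_natCast,
    show (q ^ 2) ^ (4 * N + 1) = q ^ (2 * (4 * N + 1)) from (pow_mul _ _ _).symm]
  have d1 : 1 - q ≠ 0 := by simpa using hne 1 one_pos
  have d2 : 1 - q ^ 2 ≠ 0 := hne 2 two_pos
  have d3 : 1 + q ^ 2 ≠ 0 := fun h => hne 4 (by omega) (by linear_combination (1 - q ^ 2) * h)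
  generalize ∑ k ∈ range (N + 1), (1 - (q ^ 8) ^ k) * (1 - q ^ 2 * (q ^ 8) ^ k) / (q ^ 8) ^ k *
        ((1 - q ^ 2 * (q ^ 8) ^ (2 * k)) *
          wellPoised (q ^ 2) (q ^ 2) (q ^ 2 / a) (a * q ^ 2) (q ^ 8) k) = S at *
  rw [mul_div_assoc (_ / _) (qPoch _ _ _), mul_assoc (_ / _) (_ / _) ((q ^ 2) ^ N)⁻¹]
  generalize qPoch (q ^ 4) (q ^ 8) N / qPoch (q ^ 8) (q ^ 8) N * ((q ^ 2) ^ N)⁻¹ = B at *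
  generalize q ^ (2 * (4 * N + 1)) = Q at *
  have hS : (1 + q ^ 2) * S = -(1 - q ^ 2 / a) * (1 - a * q ^ 2) * ((1 - Q) * B) := by
    apply mul_left_cancel₀ (mul_ne_zero hA d2)
    rw [show q ^ 2 * (q ^ 2 / a) * (a * q ^ 2) = q ^ 6 by field_simp] at hc
    linear_combination hc
  generalize 1 - q ^ 2 / a = x1 at *
  generalize 1 - a * q ^ 2 = x2 at *
  rw [div_eq_iff (by positivity)]
  apply mul_left_cancel₀ d3
  field_simp
  linear_combination hS

end Summand

section Reversal

variable {K : Type*} [Field K]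

lemma qPoch_reverse {p r y : K} (hr : r ≠ 0) (hy : y ≠ 0) (k m : ℕ) (h : p * r ^ (k + m) = 1) :
    qPoch (p * y) r m * qPoch (r / y) r k * (-y) ^ k =
      (∏ i ∈ range k, r ^ (i + 1)) * qPoch (p * y) r (k + m) := by
  induction k generalizing m with
  | zero => simp [qPoch_zero]
  | succ k ih =>
    have h' : p * r ^ (k + (m + 1)) = 1 := by rw [← h]; ring
    have hY : r ^ k ≠ 0 := pow_ne_zero _ hr
    have ih' := ih (m + 1) h'
    rw [prod_range_succ, show k + 1 + m = k + (m + 1) by ring,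
      mul_right_comm (∏ i ∈ range k, r ^ (i + 1)), ← ih',
      qPoch_succ, qPoch_succ]
    have hp : p * r ^ m * r ^ k * r = 1 := by rw [← h']; ring
    rw [pow_succ (-y) k, pow_succ r k]
    have : (1 - r / y * r ^ k) * -y = (1 - p * y * r ^ m) * (r ^ k * r) := by
      field_simp
      linear_combination y * hp
    linear_combination (qPoch (p * y) r m * qPoch (r / y) r k * (-y) ^ k) * this

lemma prod_range_pow_succ_sq (r : K) (k : ℕ) :
    (∏ i ∈ range k, r ^ (i + 1)) ^ 2 = r ^ (k * (k + 1)) := by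
  induction k with
  | zero => simp
  | succ k ih => rw [prod_range_succ, mul_pow, ih]; ring

/-- At a root of unity the terms of the series cancel in pairs. -/
lemma summand_reflect {q a : K} (hq : q ≠ 0) (ha : a ≠ 0) {k m : ℕ}
    (h : q ^ 2 * (q ^ 8) ^ (k + m) = 1) (h1 : ∀ i < k + m, 1 - q ^ 8 * (q ^ 8) ^ i ≠ 0)
    (h2 : ∀ i, 1 - a * q ^ 8 * (q ^ 8) ^ i ≠ 0) (h3 : ∀ i, 1 - q ^ 8 / a * (q ^ 8) ^ i ≠ 0) :
    summand q a m = -summand q a k := by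
  have hr : q ^ 8 ≠ 0 := pow_ne_zero _ hq
  have hk : q ^ k ≠ 0 := pow_ne_zero _ hq
  have hm : q ^ m ≠ 0 := pow_ne_zero _ hq
  have key : ∀ k m : ℕ, q ^ 2 * (q ^ 8) ^ (k + m) = 1 →
      qPoch (q ^ 2) (q ^ 8) m ^ 2 * qPoch (a * q ^ 2) (q ^ 8) m * qPoch (q ^ 2 / a) (q ^ 8) m *
      (qPoch (q ^ 8) (q ^ 8) k ^ 2 * qPoch (a * q ^ 8) (q ^ 8) k * qPoch (q ^ 8 / a) (q ^ 8) k) =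
      (q ^ 8) ^ (2 * (k * (k + 1))) * (qPoch (q ^ 2) (q ^ 8) (k + m) ^ 2 *
        qPoch (a * q ^ 2) (q ^ 8) (k + m) * qPoch (q ^ 2 / a) (q ^ 8) (k + m)) := by
    intro k m h
    have r1 := qPoch_reverse hr one_ne_zero k m h
    have r2 := qPoch_reverse hr ha k m h
    have r3 := qPoch_reverse hr (inv_ne_zero ha) k m h
    rw [mul_one, div_one] at r1
    rw [mul_comm (q ^ 2) a] at r2
    rw [← div_eq_mul_inv, div_inv_eq_mul, mul_comm _ a] at r3
    have hs : (-1 : K) ^ k * (-1) ^ k * ((-a) ^ k * (-a⁻¹) ^ k) = 1 := by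
      rw [← mul_pow, ← mul_pow, ← mul_pow]
      field_simp
      simp
    have ht : (q ^ 8) ^ (2 * (k * (k + 1))) = (∏ i ∈ range k, (q ^ 8) ^ (i + 1)) ^ 4 := by
      rw [mul_comm 2, pow_mul, ← prod_range_pow_succ_sq, ← pow_mul]
    rw [ht, ← mul_one (_ * _), ← hs]
    generalize ∏ i ∈ range k, (q ^ 8) ^ (i + 1) = T at *
    calc _ = (qPoch (q ^ 2) (q ^ 8) m * qPoch (q ^ 8) (q ^ 8) k * (-1) ^ k) ^ 2 *
          (qPoch (a * q ^ 2) (q ^ 8) m * qPoch (q ^ 8 / a) (q ^ 8) k * (-a) ^ k) *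
          (qPoch (q ^ 2 / a) (q ^ 8) m * qPoch (a * q ^ 8) (q ^ 8) k * (-a⁻¹) ^ k) := by ring
      _ = _ := by rw [r1, r2, r3]; ring
  have k1 := key k m h
  have k2 := key m k (by rw [add_comm]; exact h)
  rw [add_comm m k] at k2
  have n1 : ∀ j ≤ k + m, qPoch (q ^ 8) (q ^ 8) j ^ 2 * qPoch (a * q ^ 8) (q ^ 8) j *
      qPoch (q ^ 8 / a) (q ^ 8) j ≠ 0 := fun j hj =>
    mul_ne_zero (mul_ne_zero (pow_ne_zero _ (qPoch_ne_zero fun i hi => h1 i (by omega)))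
      (qPoch_ne_zero fun i _ => h2 i)) (qPoch_ne_zero fun i _ => h3 i)
  have nk := n1 k (by omega)
  have nm := n1 m (by omega)
  simp only [summand]
  generalize qPoch (q ^ 8) (q ^ 8) k ^ 2 * qPoch (a * q ^ 8) (q ^ 8) k *
      qPoch (q ^ 8 / a) (q ^ 8) k = Dk at *
  generalize qPoch (q ^ 8) (q ^ 8) m ^ 2 * qPoch (a * q ^ 8) (q ^ 8) m *
      qPoch (q ^ 8 / a) (q ^ 8) m = Dm at *
  generalize qPoch (q ^ 2) (q ^ 8) k ^ 2 * qPoch (a * q ^ 2) (q ^ 8) k *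
      qPoch (q ^ 2 / a) (q ^ 8) k = Nk at *
  generalize qPoch (q ^ 2) (q ^ 8) m ^ 2 * qPoch (a * q ^ 2) (q ^ 8) m *
      qPoch (q ^ 2 / a) (q ^ 8) m = Nm at *
  generalize qPoch (q ^ 2) (q ^ 8) (k + m) ^ 2 *
        qPoch (a * q ^ 2) (q ^ 8) (k + m) * qPoch (q ^ 2 / a) (q ^ 8) (k + m) = C at *
  have hE : (q ^ 8) ^ (2 * (m * (m + 1))) * (q ^ 4) ^ m * ((q ^ 8) ^ k) ^ 2 =
      (q ^ 8) ^ (2 * (k * (k + 1))) * (q ^ 4) ^ k * ((q ^ 8) ^ m) ^ 2 := by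
    calc _ = (q ^ 8) ^ (2 * (m * (m + 1))) * (q ^ 4) ^ m * ((q ^ 8) ^ k) ^ 2 *
          (q ^ 2 * (q ^ 8) ^ (k + m)) ^ (2 * k) := by rw [h, one_pow, mul_one]
      _ = (q ^ 8) ^ (2 * (k * (k + 1))) * (q ^ 4) ^ k * ((q ^ 8) ^ m) ^ 2 *
          (q ^ 2 * (q ^ 8) ^ (k + m)) ^ (2 * m) := by ring
      _ = _ := by rw [h, one_pow, mul_one]
  have hpow : ∀ j : ℕ, q ^ (-4 * (j : ℤ)) = ((q ^ 4) ^ j)⁻¹ := fun j => by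
    rw [← pow_mul, ← zpow_natCast, ← zpow_neg]
    congr 1
  rw [qInt_eight_mul_add_one, qInt_eight_mul_add_one, qInt_eight_mul_add_one,
    qInt_eight_mul_add_one, hpow, hpow]
  have hW : ∀ j : ℕ, (q ^ 4) ^ j ≠ 0 := fun j => pow_ne_zero _ (pow_ne_zero _ hq)
  have hYZ : q ^ 2 * ((q ^ 8) ^ k * (q ^ 8) ^ m) = 1 := by rw [← h]; ring
  have e : ∀ j : ℕ, q ^ (8 * j + 1) = q * (q ^ 8) ^ j := fun j => by ring
  have e' : ∀ j : ℕ, (q ^ 2) ^ (8 * j + 1) = q ^ 2 * ((q ^ 8) ^ j) ^ 2 := fun j => by ring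
  rw [e, e, e', e']
  have hY : (q ^ 8) ^ k ≠ 0 := pow_ne_zero _ hr
  have hZ : (q ^ 8) ^ m ≠ 0 := pow_ne_zero _ hr
  have w1 := hW k
  have w2 := hW m
  generalize (q ^ 4) ^ k = u at *
  generalize (q ^ 4) ^ m = v at *
  generalize (q ^ 8) ^ (2 * (k * (k + 1))) = Ek at *
  generalize (q ^ 8) ^ (2 * (m * (m + 1))) = Em at *
  generalize (q ^ 8) ^ k = Y at *
  generalize (q ^ 8) ^ m = Z at *
  have hfac : (1 - q ^ 2 * Z ^ 2) * (1 - q * Z) ^ 2 * Y ^ 2 =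
      -((1 - q ^ 2 * Y ^ 2) * (1 - q * Y) ^ 2 * Z ^ 2) := by
    have f1 : (1 - q ^ 2 * Z ^ 2) * Y = Y - Z := by linear_combination -Z * hYZ
    have f2 : (1 - q ^ 2 * Y ^ 2) * Z = Z - Y := by linear_combination -Y * hYZ
    have f3 : (1 - q * Z) ^ 2 * Y = (1 - q * Y) ^ 2 * Z := by
      linear_combination (Z - Y) * hYZ
    linear_combination (1 - q * Z) ^ 2 * Y * f1 + (Y - Z) * f3 +
      (1 - q * Y) ^ 2 * Z * f2
  have hfac' : (1 - q ^ 2 * Z ^ 2) * (1 - q * Z) ^ 2 * (Ek * u) =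
      -((1 - q ^ 2 * Y ^ 2) * (1 - q * Y) ^ 2 * (Em * v)) := by
    apply mul_left_cancel₀ (pow_ne_zero 2 hZ)
    linear_combination -((1 - q ^ 2 * Z ^ 2) * (1 - q * Z) ^ 2) * hE + Em * v * hfac
  have hmain : (1 - q ^ 2 * Z ^ 2) * (1 - q * Z) ^ 2 * (Nm / Dm * v⁻¹) =
      -((1 - q ^ 2 * Y ^ 2) * (1 - q * Y) ^ 2 * (Nk / Dk * u⁻¹)) := by
    rw [← eq_div_iff nk] at k1
    rw [← eq_div_iff nm] at k2
    rw [k1, k2]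
    field_simp
    linear_combination C * hfac'
  simp only [div_eq_mul_inv] at hmain ⊢
  linear_combination (1 - q ^ 2)⁻¹ * (1 - q)⁻¹ ^ 2 * hmain

lemma sum_summand_eq_zero [CharZero K] {q a : K} (hq : q ≠ 0) (ha : a ≠ 0) {N m : ℕ}
    (hNm : N < m)
    (h : q ^ 2 * (q ^ 8) ^ N = 1) (h1 : ∀ i, i + 1 < m → 1 - q ^ 8 * (q ^ 8) ^ i ≠ 0)
    (h2 : ∀ i, 1 - a * q ^ 8 * (q ^ 8) ^ i ≠ 0) (h3 : ∀ i, 1 - q ^ 8 / a * (q ^ 8) ^ i ≠ 0) :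
    ∑ k ∈ range m, summand q a k = 0 := by
  obtain ⟨c, rfl⟩ : ∃ c, m = N + 1 + c := ⟨m - (N + 1), by omega⟩
  have hz : ∀ i, summand q a (N + 1 + i) = 0 := fun i => by
    have : qPoch (q ^ 2) (q ^ 8) (N + 1 + i) = 0 :=
      qPoch_eq_zero (i := N) (by omega) (by rw [h, sub_self])
    simp [summand, this]
  rw [sum_range_add, sum_eq_zero (fun i _ => hz i), add_zero]
  have hrefl := sum_range_reflect (summand q a) (N + 1)
  have : ∑ j ∈ range (N + 1), summand q a (N + 1 - 1 - j) =
      -∑ j ∈ range (N + 1), summand q a j := by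
    rw [← sum_neg_distrib]
    refine sum_congr rfl fun j hj => ?_
    have hj := mem_range.1 hj
    have e : j + (N + 1 - 1 - j) = N := by omega
    exact summand_reflect hq ha (by rw [e, h]) (fun i hi => h1 i (by omega)) h2 h3
  rw [this] at hrefl
  exact self_eq_neg.1 hrefl.symm

end Reversal

section EvalAt

variable {F L : Type*} [Field F] [Field L] [Algebra F L]

/-- The rational function `x` is defined at `α` and takes the value `v` there. -/
def EvalAt (α : L) (x : RatFunc F) (v : L) : Prop :=
  ∃ f g : F[X], aeval α g ≠ 0 ∧ aeval α f = v * aeval α g ∧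
    x * algebraMap F[X] (RatFunc F) g = algebraMap F[X] (RatFunc F) f

namespace EvalAt

variable {α : L} {x y : RatFunc F} {v w : L}

lemma polynomial (p : F[X]) : EvalAt α (algebraMap F[X] (RatFunc F) p) (aeval α p) :=
  ⟨p, 1, by simp⟩

lemma X : EvalAt α (RatFunc.X : RatFunc F) α := by
  simpa using polynomial (α := α) (Polynomial.X : F[X])

lemma C (c : F) : EvalAt α (RatFunc.C c) (algebraMap F L c) := by
  simpa using polynomial (α := α) (Polynomial.C c)

lemma one : EvalAt α (1 : RatFunc F) (1 : L) := by
  simpa using polynomial (α := α) (1 : F[X])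

lemma zero : EvalAt α (0 : RatFunc F) (0 : L) := by
  simpa using polynomial (α := α) (0 : F[X])

lemma add (hx : EvalAt α x v) (hy : EvalAt α y w) : EvalAt α (x + y) (v + w) := by
  obtain ⟨f, g, h1, h2, h3⟩ := hx
  obtain ⟨f', g', h1', h2', h3'⟩ := hy
  refine ⟨f * g' + f' * g, g * g', by simp [h1, h1'], ?_, ?_⟩
  · simp only [map_add, map_mul, h2, h2']; ring
  · simp only [map_add, map_mul, ← h3, ← h3']; ring

lemma mul (hx : EvalAt α x v) (hy : EvalAt α y w) : EvalAt α (x * y) (v * w) := by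
  obtain ⟨f, g, h1, h2, h3⟩ := hx
  obtain ⟨f', g', h1', h2', h3'⟩ := hy
  refine ⟨f * f', g * g', by simp [h1, h1'], ?_, ?_⟩
  · simp only [map_mul, h2, h2']; ring
  · simp only [map_mul, ← h3, ← h3']; ring

lemma neg (hx : EvalAt α x v) : EvalAt α (-x) (-v) := by
  obtain ⟨f, g, h1, h2, h3⟩ := hx
  exact ⟨-f, g, h1, by simp [h2], by simp [h3]⟩

lemma sub (hx : EvalAt α x v) (hy : EvalAt α y w) : EvalAt α (x - y) (v - w) := by
  simpa [sub_eq_add_neg] using hx.add hy.neg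

lemma inv (hx : EvalAt α x v) (hv : v ≠ 0) : EvalAt α x⁻¹ v⁻¹ := by
  obtain ⟨f, g, h1, h2, h3⟩ := hx
  have hf : aeval α f ≠ 0 := by rw [h2]; exact mul_ne_zero hv h1
  have hx0 : x ≠ 0 := by
    rintro rfl
    rw [zero_mul, eq_comm, map_eq_zero_iff _ (RatFunc.algebraMap_injective F)] at h3
    exact hf (by simp [h3])
  refine ⟨g, f, hf, ?_, ?_⟩
  · rw [h2, inv_mul_cancel_left₀ hv]
  · rw [← h3, inv_mul_cancel_left₀ hx0]

lemma div (hx : EvalAt α x v) (hy : EvalAt α y w) (hw : w ≠ 0) : EvalAt α (x / y) (v / w) := by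
  simpa [div_eq_mul_inv] using hx.mul (hy.inv hw)

lemma pow (hx : EvalAt α x v) (k : ℕ) : EvalAt α (x ^ k) (v ^ k) := by
  induction k with
  | zero => simpa using one
  | succ k ih => simpa [pow_succ] using ih.mul hx

lemma zpow (hx : EvalAt α x v) (hv : v ≠ 0) (k : ℤ) : EvalAt α (x ^ k) (v ^ k) := by
  cases k with
  | ofNat k => simpa using hx.pow k
  | negSucc k => simpa using (hx.pow (k + 1)).inv (pow_ne_zero _ hv)

lemma sum {f : ℕ → RatFunc F} {g : ℕ → L} {s : Finset ℕ} (h : ∀ i ∈ s, EvalAt α (f i) (g i)) :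
    EvalAt α (∑ i ∈ s, f i) (∑ i ∈ s, g i) := by
  induction s using Finset.cons_induction with
  | empty => simpa using zero
  | cons i s hi ih =>
    rw [sum_cons, sum_cons]
    exact (h i (mem_cons_self _ _)).add (ih fun j hj => h j (mem_cons_of_mem hj))

lemma prod {f : ℕ → RatFunc F} {g : ℕ → L} {s : Finset ℕ} (h : ∀ i ∈ s, EvalAt α (f i) (g i)) :
    EvalAt α (∏ i ∈ s, f i) (∏ i ∈ s, g i) := by
  induction s using Finset.cons_induction with
  | empty => simpa using one
  | cons i s hi ih =>
    rw [prod_cons, prod_cons]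
    exact (h i (mem_cons_self _ _)).mul (ih fun j hj => h j (mem_cons_of_mem hj))

lemma qPoch (hx : EvalAt α x v) (hy : EvalAt α y w) (k : ℕ) :
    EvalAt α (qPoch x y k) (qPoch v w k) :=
  prod fun i _ => one.sub (hx.mul (hy.pow i))

lemma qInt (hx : EvalAt α x v) (hv0 : v ≠ 0) (hv : 1 - v ≠ 0) (z : ℤ) :
    EvalAt α (qInt x z) (qInt v z) :=
  (one.sub (hx.zpow hv0 z)).div (one.sub hx) hv

end EvalAt

/-- A rational function vanishing at all roots of a separable polynomial `M` is divisible by `M`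
in the localization at `M`. -/
lemma exists_eq_mul_of_evalAt_zero [IsAlgClosed L] {M : F[X]} (hM : M.Separable) {x : RatFunc F}
    (h : ∀ α : L, aeval α M = 0 → EvalAt α x 0) :
    ∃ f g : F[X], IsCoprime M g ∧ x * algebraMap F[X] (RatFunc F) g =
      algebraMap F[X] (RatFunc F) M * algebraMap F[X] (RatFunc F) f := by
  classical
  have hx : x * algebraMap F[X] (RatFunc F) x.denom = algebraMap F[X] (RatFunc F) x.num := by
    have := RatFunc.algebraMap_ne_zero (RatFunc.denom_ne_zero x)
    rw [← eq_div_iff this, RatFunc.num_div_denom]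
  have hroot : ∀ α : L, aeval α M = 0 → aeval α x.denom ≠ 0 ∧ aeval α x.num = 0 := by
    intro α hα
    obtain ⟨f, g, h1, h2, h3⟩ := h α hα
    have hfg : x.num * g = f * x.denom := by
      apply RatFunc.algebraMap_injective F
      rw [map_mul, map_mul, ← h3, ← hx]
      ring
    have hnum : aeval α x.num = 0 := by
      have := congrArg (aeval α) hfg
      rw [map_mul, map_mul, h2, zero_mul, zero_mul] at this
      exact (mul_eq_zero.1 this).resolve_right h1
    refine ⟨fun hd => ?_, hnum⟩
    obtain ⟨u, v, huv⟩ := RatFunc.isCoprime_num_denom x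
    have := congrArg (aeval α) huv
    simp [hd, hnum] at this
  have hcop : ∀ p p' : F[X], (∀ α : L, ¬ (aeval α p = 0 ∧ aeval α p' = 0)) → IsCoprime p p' := by
    intro p p' hpp
    refine (Polynomial.isCoprime_iff_aeval_ne_zero_of_isAlgClosed F L p p').2 fun α => ?_
    have := hpp α
    tauto
  have hdvd : M ∣ x.num := by
    obtain ⟨m, hm⟩ := EuclideanDomain.gcd_dvd_left M x.num
    have hsep : IsCoprime (EuclideanDomain.gcd M x.num) m := by
      rw [hm] at hM
      exact hM.isCoprime
    have hunit : IsUnit m := by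
      rw [← isCoprime_self]
      refine hcop _ _ fun α hα => ?_
      have hMα : aeval α M = 0 := by rw [hm, map_mul, hα.1, mul_zero]
      have hgα : aeval α (EuclideanDomain.gcd M x.num) = 0 := by
        rw [EuclideanDomain.gcd_eq_gcd_ab, map_add, map_mul, map_mul, hMα, (hroot α hMα).2]
        simp
      obtain ⟨u, v, huv⟩ := hsep
      have := congrArg (aeval α) huv
      simp [hgα, hα.1] at this
    have : M ∣ EuclideanDomain.gcd M x.num := by
      rw [← hunit.dvd_mul_right, ← hm]
    exact this.trans (EuclideanDomain.gcd_dvd_right _ _)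
  obtain ⟨f, hf⟩ := hdvd
  exact ⟨f, x.denom, hcop _ _ fun α hα => (hroot α hα.1).1 hα.2, by rw [hx, hf, map_mul]⟩

end EvalAt

section RootOfUnity

variable {F L : Type*} [Field F] [Field L] [Algebra F L]

lemma qPoch_add_eq_mul {K : Type*} [Field K] (x r : K) (j k : ℕ) :
    qPoch x r (j + k) = qPoch x r j * qPoch (x * r ^ j) r k := by
  simp [qPoch, prod_range_add, pow_add, mul_assoc]

lemma one_sub_ratFuncX_pow_ne_zero {m : ℕ} (hm : 0 < m) : 1 - (RatFunc.X : RatFunc F) ^ m ≠ 0 := by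
  intro h
  have : algebraMap F[X] (RatFunc F) (Polynomial.X ^ m - Polynomial.C 1) = 0 := by
    simp only [map_sub, map_pow, RatFunc.algebraMap_X, map_one]
    linear_combination -h
  rw [map_eq_zero_iff _ (RatFunc.algebraMap_injective F)] at this
  exact Polynomial.X_pow_sub_C_ne_zero hm 1 this

lemma one_sub_pow_succ_ne_zero {r : L} {d i : ℕ} (hr : IsPrimitiveRoot r d) (hi : i + 1 < d) :
    1 - r * r ^ i ≠ 0 := fun h => by
  rw [← pow_succ', sub_eq_zero] at h
  exact hr.pow_ne_one_of_pos_of_lt (Nat.succ_ne_zero i) hi h.symm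

/-- Over a full period, the zeros of the denominator at a root of unity are compensated. -/
lemma exists_evalAt_period [CharZero L] {α : L} {d c e i₀ t u : ℕ} (hd : 0 < d)
    (hα : α ^ (2 * d) = 1) (hr : IsPrimitiveRoot (α ^ 8) d) (hi₀ : i₀ < d)
    (hc : c + 8 * i₀ = 2 * d * t) (he : e + 8 * d = 2 * d * u) (hu : 0 < u)
    (heα : α ^ e = 1) :
    ∃ v, EvalAt α (qPoch ((RatFunc.X : RatFunc F) ^ c) (RatFunc.X ^ 8) d /
      qPoch (RatFunc.X ^ 8 * RatFunc.X ^ e) (RatFunc.X ^ 8) d) v := by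
  obtain ⟨d, rfl⟩ : ∃ d', d = d' + 1 := ⟨d - 1, by omega⟩
  have hX : EvalAt α (RatFunc.X : RatFunc F) α := EvalAt.X
  set Q : RatFunc F := RatFunc.X ^ (2 * (d + 1)) with hQ
  have hQ1 : 1 - Q ≠ 0 := one_sub_ratFuncX_pow_ne_zero (by omega)
  have hden : qPoch (RatFunc.X ^ 8 * RatFunc.X ^ e : RatFunc F) (RatFunc.X ^ 8) (d + 1) =
      qPoch (RatFunc.X ^ 8 * RatFunc.X ^ e) (RatFunc.X ^ 8) d *
        ((1 - Q) * ∑ i ∈ range u, Q ^ i) := by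
    rw [qPoch_succ, mul_neg_geom_sum, hQ, ← pow_mul _ (2 * (d + 1)) u, ← he]
    ring
  have hnum : qPoch ((RatFunc.X : RatFunc F) ^ c) (RatFunc.X ^ 8) (d + 1) =
      (∏ i ∈ (range (d + 1)).erase i₀, (1 - RatFunc.X ^ c * (RatFunc.X ^ 8) ^ i)) *
        ((1 - Q) * ∑ i ∈ range t, Q ^ i) := by
    rw [qPoch, ← prod_erase_mul _ _ (mem_range.2 hi₀), mul_neg_geom_sum, hQ,
      ← pow_mul _ (2 * (d + 1)) t, ← hc]
    ring
  have hgeom : ∀ m, EvalAt α (∑ i ∈ range m, Q ^ i) (m : L) := fun m => by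
    have : EvalAt α (∑ i ∈ range m, Q ^ i) (∑ i ∈ range m, (α ^ (2 * (d + 1))) ^ i) :=
      EvalAt.sum fun i _ => (hX.pow _).pow i
    simpa [hα] using this
  have heq : qPoch ((RatFunc.X : RatFunc F) ^ c) (RatFunc.X ^ 8) (d + 1) /
      qPoch (RatFunc.X ^ 8 * RatFunc.X ^ e) (RatFunc.X ^ 8) (d + 1) =
      (∏ i ∈ (range (d + 1)).erase i₀, (1 - RatFunc.X ^ c * (RatFunc.X ^ 8) ^ i)) *
        (∑ i ∈ range t, Q ^ i) /
        (qPoch (RatFunc.X ^ 8 * RatFunc.X ^ e) (RatFunc.X ^ 8) d * ∑ i ∈ range u, Q ^ i) := by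
    rw [hden, hnum, mul_left_comm, mul_left_comm _ (1 - Q), mul_div_mul_left _ _ hQ1]
  rw [heq]
  refine ⟨_, EvalAt.div (EvalAt.mul (EvalAt.prod fun i _ =>
    EvalAt.one.sub ((hX.pow c).mul ((hX.pow 8).pow i))) (hgeom t))
    (EvalAt.mul (((hX.pow 8).mul (hX.pow e)).qPoch (hX.pow 8) d) (hgeom u)) ?_⟩
  refine mul_ne_zero (qPoch_ne_zero fun i hi => ?_) (Nat.cast_ne_zero.2 hu.ne')
  rw [heα, mul_one]
  exact one_sub_pow_succ_ne_zero hr (by omega)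

lemma exists_evalAt_qPoch_div [CharZero L] {α : L} {d c M : ℕ} (hd : 0 < d)
    (hα : α ^ (2 * d) = 1) (hr : IsPrimitiveRoot (α ^ 8) d) (hc : 2 * d ∣ c + 8 * M) (k : ℕ) :
    ∃ v, EvalAt α (qPoch ((RatFunc.X : RatFunc F) ^ c) (RatFunc.X ^ 8) k /
      qPoch (RatFunc.X ^ 8) (RatFunc.X ^ 8) k) v := by
  have hX : EvalAt α (RatFunc.X : RatFunc F) α := EvalAt.X
  have hper : ∀ j, α ^ (8 * (j * d)) = 1 := fun j => by
    rw [show 8 * (j * d) = 2 * d * (4 * j) by ring, pow_mul, hα, one_pow]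
  have hblock : ∀ j, ∃ v, EvalAt α (qPoch ((RatFunc.X : RatFunc F) ^ c) (RatFunc.X ^ 8) (j * d) /
      qPoch (RatFunc.X ^ 8) (RatFunc.X ^ 8) (j * d)) v := by
    intro j
    induction j with
    | zero => exact ⟨1, by simpa [qPoch_zero] using EvalAt.one⟩
    | succ j ih =>
      obtain ⟨v, hv⟩ := ih
      have hMd : 8 * M = 8 * (M % d) + 2 * d * (4 * (M / d)) := by
        conv_lhs => rw [← Nat.mod_add_div M d]
        ring
      obtain ⟨t, ht⟩ : 2 * d ∣ c + 8 * (M % d) := by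
        rw [hMd, ← add_assoc] at hc
        exact (Nat.dvd_add_left (dvd_mul_right _ _)).1 hc
      obtain ⟨w, hw⟩ := exists_evalAt_period (F := F) (c := c + 8 * (j * d)) (e := 8 * (j * d))
        (t := t + 4 * j) (u := 4 * j + 4) hd hα hr (Nat.mod_lt M hd)
        (by rw [mul_add, ← ht]; ring) (by ring) (by omega) (hper j)
      refine ⟨v * w, ?_⟩
      rw [Nat.succ_mul, qPoch_add_eq_mul, qPoch_add_eq_mul, mul_div_mul_comm, ← pow_mul,
        ← pow_add]
      exact hv.mul hw
  obtain ⟨v, hv⟩ := hblock (k / d)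
  rw [← Nat.div_add_mod' k d, qPoch_add_eq_mul, qPoch_add_eq_mul, mul_div_mul_comm]
  refine ⟨_, hv.mul (EvalAt.div (((hX.pow _).mul ((hX.pow 8).pow _)).qPoch (hX.pow 8) _)
    (((hX.pow 8).mul ((hX.pow 8).pow _)).qPoch (hX.pow 8) _)
    (qPoch_ne_zero fun i hi => ?_))⟩
  rw [← pow_mul α 8 (k / d * d), hper, mul_one]
  exact one_sub_pow_succ_ne_zero hr (by have := Nat.mod_lt k hd; omega)

variable {a : RatFunc F} {b α : L}

/-- The summands of one period are, up to a common factor that is defined at the root of unity,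
given there by the summands of the first period. -/
lemma evalAt_sum_period [CharZero L] (ha : EvalAt α a b) {d n N m : ℕ} (hd : 0 < d) (hα0 : α ≠ 0)
    (hα1 : 1 - α ^ 2 ≠ 0) (hb : b ≠ 0)
    (hα : α ^ (2 * d) = 1) (hr : IsPrimitiveRoot (α ^ 8) d) (hn : d ∣ n) (hN : n = 4 * N + 1)
    (h2 : ∀ i, 1 - b * α ^ 8 * (α ^ 8) ^ i ≠ 0) (h3 : ∀ i, 1 - α ^ 8 / b * (α ^ 8) ^ i ≠ 0)
    (hm : N % d < m) (hmd : m ≤ d) (j : ℕ) :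
    EvalAt α (∑ k ∈ range m, summand RatFunc.X a (j * d + k)) 0 := by
  have hX : EvalAt α (RatFunc.X : RatFunc F) α := EvalAt.X
  have hα2 : 1 - α ≠ 0 := fun h => hα1 (by linear_combination (1 + α) * h)
  have hcdvd : 2 * d ∣ 2 + 8 * N := by
    rw [show 2 + 8 * N = 2 * n by omega]; exact mul_dvd_mul_left 2 hn
  have hper : ∀ j, α ^ (2 * d * j) = 1 := fun j => by rw [pow_mul, hα, one_pow]
  obtain ⟨v, hv⟩ := exists_evalAt_qPoch_div (F := F) hd hα hr hcdvd (j * d)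
  set s := j * d with hs
  have hs8 : (α ^ 8) ^ s = 1 := by
    rw [← pow_mul, hs, show 8 * (j * d) = 2 * d * (4 * j) by ring, hper]
  set V : RatFunc F := (qPoch (RatFunc.X ^ 2) (RatFunc.X ^ 8) s /
      qPoch (RatFunc.X ^ 8) (RatFunc.X ^ 8) s) ^ 2 *
    (qPoch (a * RatFunc.X ^ 2) (RatFunc.X ^ 8) s * qPoch (RatFunc.X ^ 2 / a) (RatFunc.X ^ 8) s /
      (qPoch (a * RatFunc.X ^ 8) (RatFunc.X ^ 8) s *
        qPoch (RatFunc.X ^ 8 / a) (RatFunc.X ^ 8) s)) with hV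
  have hVe : ∃ w, EvalAt α V w :=
    ⟨_, (hv.pow 2).mul (EvalAt.div (((ha.mul (hX.pow 2)).qPoch (hX.pow 8) s).mul
      (((hX.pow 2).div ha hb).qPoch (hX.pow 8) s)) (((ha.mul (hX.pow 8)).qPoch (hX.pow 8) s).mul
      (((hX.pow 8).div ha hb).qPoch (hX.pow 8) s))
      (mul_ne_zero (qPoch_ne_zero fun i _ => h2 i) (qPoch_ne_zero fun i _ => h3 i)))⟩
  obtain ⟨w, hw⟩ := hVe
  have hterm : ∀ k < m, ∃ W, EvalAt α W (summand α b k) ∧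
      summand RatFunc.X a (s + k) = V * W := by
    intro k hk
    refine ⟨qInt (RatFunc.X ^ 2) (8 * ((s + k : ℕ) : ℤ) + 1) *
      qInt RatFunc.X (8 * ((s + k : ℕ) : ℤ) + 1) ^ 2 *
      (qPoch (RatFunc.X ^ 2 * (RatFunc.X ^ 8) ^ s) (RatFunc.X ^ 8) k ^ 2 *
        qPoch (a * RatFunc.X ^ 2 * (RatFunc.X ^ 8) ^ s) (RatFunc.X ^ 8) k *
        qPoch (RatFunc.X ^ 2 / a * (RatFunc.X ^ 8) ^ s) (RatFunc.X ^ 8) k) /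
      (qPoch (RatFunc.X ^ 8 * (RatFunc.X ^ 8) ^ s) (RatFunc.X ^ 8) k ^ 2 *
        qPoch (a * RatFunc.X ^ 8 * (RatFunc.X ^ 8) ^ s) (RatFunc.X ^ 8) k *
        qPoch (RatFunc.X ^ 8 / a * (RatFunc.X ^ 8) ^ s) (RatFunc.X ^ 8) k) *
      RatFunc.X ^ (-4 * ((s + k : ℕ) : ℤ)), ?_, ?_⟩
    · have p : ∀ {x : RatFunc F} {y : L}, EvalAt α x y →
          EvalAt α (qPoch (x * (RatFunc.X ^ 8) ^ s) (RatFunc.X ^ 8) k)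
            (qPoch y (α ^ 8) k) := fun {x y} hx => by
        have := (hx.mul ((hX.pow 8).pow s)).qPoch (hX.pow 8) k
        rwa [hs8, mul_one] at this
      have hD : qPoch (α ^ 8) (α ^ 8) k ^ 2 * qPoch (b * α ^ 8) (α ^ 8) k *
          qPoch (α ^ 8 / b) (α ^ 8) k ≠ 0 :=
        mul_ne_zero (mul_ne_zero (pow_ne_zero _ (qPoch_ne_zero fun i hi =>
          one_sub_pow_succ_ne_zero hr (by omega)))
          (qPoch_ne_zero fun i _ => h2 i)) (qPoch_ne_zero fun i _ => h3 i)
      have i1 := (hX.pow 2).qInt (pow_ne_zero 2 hα0) hα1 (8 * ((s + k : ℕ) : ℤ) + 1)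
      have i2 := hX.qInt hα0 hα2 (8 * ((s + k : ℕ) : ℤ) + 1)
      have i3 := hX.zpow hα0 (-4 * ((s + k : ℕ) : ℤ))
      have j1 : qInt (α ^ 2) (8 * ((s + k : ℕ) : ℤ) + 1) = qInt (α ^ 2) (8 * (k : ℤ) + 1) := by
        rw [qInt_eight_mul_add_one, qInt_eight_mul_add_one, ← pow_mul, ← pow_mul,
          show 2 * (8 * (s + k) + 1) = 2 * d * (8 * j) + 2 * (8 * k + 1) by rw [hs]; ring,
          pow_add, hper, one_mul]
      have j2 : qInt α (8 * ((s + k : ℕ) : ℤ) + 1) = qInt α (8 * (k : ℤ) + 1) := by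
        rw [qInt_eight_mul_add_one, qInt_eight_mul_add_one,
          show 8 * (s + k) + 1 = 2 * d * (4 * j) + (8 * k + 1) by rw [hs]; ring,
          pow_add, hper, one_mul]
      have j3 : α ^ (-4 * ((s + k : ℕ) : ℤ)) = α ^ (-4 * (k : ℤ)) := by
        have : -4 * ((s + k : ℕ) : ℤ) = -((2 * d * (2 * j) : ℕ) : ℤ) + -4 * (k : ℤ) := by
          rw [hs]; push_cast; ring
        rw [this, zpow_add₀ hα0, zpow_neg, zpow_natCast, hper, inv_one, one_mul]
      rw [j1] at i1
      rw [j2] at i2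
      rw [j3] at i3
      exact ((i1.mul (i2.pow 2)).mul ((((p (hX.pow 2)).pow 2).mul (p (ha.mul (hX.pow 2)))).mul
        (p ((hX.pow 2).div ha hb)))).div ((((p (hX.pow 8)).pow 2).mul
        (p (ha.mul (hX.pow 8)))).mul (p ((hX.pow 8).div ha hb))) hD |>.mul i3
    · rw [summand, hV]
      simp only [qPoch_add_eq_mul, div_eq_mul_inv, mul_inv, mul_pow, inv_pow]
      ring
  choose! W hW1 hW2 using hterm
  rw [sum_congr rfl fun k hk => hW2 k (mem_range.1 hk), ← mul_sum]
  have hz : ∑ k ∈ range m, summand α b k = 0 := by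
    refine sum_summand_eq_zero hα0 hb hm ?_ (fun i hi => one_sub_pow_succ_ne_zero hr (by omega))
      h2 h3
    obtain ⟨t, ht⟩ := hcdvd
    have : 2 + 8 * (N % d) + 2 * d * (4 * (N / d)) = 2 * d * t := by
      rw [← ht]
      conv_rhs => rw [← Nat.mod_add_div N d]
      ring
    rw [← pow_mul, ← pow_add, ← hper t, ← this, pow_add _ (2 + _), hper, mul_one]
  have := hw.mul (EvalAt.sum (s := range m) fun k hk => hW1 k (mem_range.1 hk))
  rwa [hz, mul_zero] at this

lemma evalAt_sum_zero_of_rootOfUnity [CharZero L] (ha : EvalAt α a b) {d n N : ℕ} (hd : 0 < d)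
    (hα0 : α ≠ 0) (hα1 : 1 - α ^ 2 ≠ 0) (hb : b ≠ 0)
    (hα : α ^ (2 * d) = 1) (hr : IsPrimitiveRoot (α ^ 8) d) (hn : d ∣ n) (hN : n = 4 * N + 1)
    (h2 : ∀ i, 1 - b * α ^ 8 * (α ^ 8) ^ i ≠ 0) (h3 : ∀ i, 1 - α ^ 8 / b * (α ^ 8) ^ i ≠ 0) :
    EvalAt α (∑ k ∈ range (N + 1), summand RatFunc.X a k) 0 := by
  have hlt := Nat.mod_lt N hd
  have hblocks : ∀ j, EvalAt α (∑ k ∈ range (j * d), summand RatFunc.X a k) 0 := by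
    intro j
    induction j with
    | zero => simpa using EvalAt.zero
    | succ j ih =>
      rw [Nat.succ_mul, sum_range_add]
      simpa using ih.add (evalAt_sum_period ha hd hα0 hα1 hb hα hr hn hN h2 h3 hlt le_rfl j)
  have hlast := evalAt_sum_period (m := N % d + 1) ha hd hα0 hα1 hb hα hr hn hN h2 h3
    (Nat.lt_succ_self (N % d)) hlt (N / d)
  have := (hblocks (N / d)).add hlast
  rw [← sum_range_add, add_zero] at this
  rwa [← Nat.add_assoc, Nat.div_add_mod'] at this

lemma evalAt_closedForm_zero_of_rootOfUnity [CharZero L] (ha : EvalAt α a b) {d n N : ℕ}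
    (hd : 0 < d) (hα0 : α ≠ 0) (hα1 : 1 - α ^ 2 ≠ 0) (hα2 : 1 + α ^ 2 ≠ 0) (hb : b ≠ 0)
    (hα : α ^ (2 * d) = 1) (hr : IsPrimitiveRoot (α ^ 8) d) (hn : d ∣ n) (hN : n = 4 * N + 1) :
    EvalAt α (closedForm RatFunc.X a n) 0 := by
  have hX : EvalAt α (RatFunc.X : RatFunc F) α := EvalAt.X
  have hα3 : 1 - α ≠ 0 := fun h => hα1 (by linear_combination (1 + α) * h)
  have hcdvd : 2 * d ∣ 4 + 8 * (2 * N) := by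
    rw [show 4 + 8 * (2 * N) = 2 * n * 2 by omega]
    exact (mul_dvd_mul_left 2 hn).mul_right 2
  obtain ⟨v, hv⟩ := exists_evalAt_qPoch_div (F := F) hd hα hr hcdvd ((n - 1) / 4)
  have h0 : EvalAt α (qInt ((RatFunc.X : RatFunc F) ^ 2) (n : ℤ)) 0 := by
    have := (hX.pow 2).qInt (pow_ne_zero 2 hα0) hα1 n
    obtain ⟨t, rfl⟩ := hn
    rwa [qInt_natCast (α ^ 2), ← pow_mul α 2, ← mul_assoc, pow_mul α (2 * d), hα, one_pow,
      sub_self, zero_div] at this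
  have := ((h0.mul hv).mul (hX.zpow hα0 (-(((n : ℤ) - 1) / 2)))).mul
    (EvalAt.one.sub (((EvalAt.one.sub (ha.mul (hX.pow 2))).mul
      (EvalAt.one.sub ((hX.pow 2).div ha hb))).div
      (((EvalAt.one.sub hX).pow 2).mul (EvalAt.one.add (hX.pow 2)))
      (mul_ne_zero (pow_ne_zero 2 hα3) hα2)))
  rw [zero_mul, zero_mul, zero_mul] at this
  rwa [closedForm, mul_div_assoc]

end RootOfUnity

section Congruence

variable {F L : Type*} [Field F] [Field L] [Algebra F L] {a : RatFunc F} {α b : L}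

/-- The congruence at the points where `a * q ^ (2 * n) = 1`. -/
lemma evalAt_sub_zero_of_mul_pow_eq_one (ha : EvalAt α a b)
    (hinj : Function.Injective fun m : ℕ => α ^ m) {n : ℕ} (hn4 : n % 4 = 1)
    (hb : b * α ^ (2 * n) = 1) :
    EvalAt α (∑ k ∈ range ((n - 1) / 4 + 1), summand RatFunc.X a k -
      closedForm RatFunc.X a n) 0 := by
  have hX : EvalAt α (RatFunc.X : RatFunc F) α := EvalAt.X
  have hb0 : b ≠ 0 := left_ne_zero_of_mul_eq_one hb
  have hα0 : α ≠ 0 := by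
    rintro rfl
    rw [zero_pow (by omega), mul_zero] at hb
    exact zero_ne_one hb
  have hpow : ∀ m, 0 < m → 1 - α ^ m ≠ 0 := fun m hm h =>
    hm.ne (hinj (by simpa using sub_eq_zero.1 h))
  have h1 : ∀ i, 1 - α ^ 8 * (α ^ 8) ^ i ≠ 0 := fun i => by
    rw [← pow_mul, ← pow_add]
    exact hpow _ (by omega)
  have h2 : ∀ i, 1 - b * α ^ 8 * (α ^ 8) ^ i ≠ 0 := fun i h => by
    rw [sub_eq_zero, mul_assoc, ← pow_mul, ← pow_add, ← hb] at h
    have := hinj (mul_left_cancel₀ hb0 h)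
    omega
  have h3 : ∀ i, 1 - α ^ 8 / b * (α ^ 8) ^ i ≠ 0 := fun i => by
    rw [div_eq_mul_inv, ← eq_inv_of_mul_eq_one_right hb, ← pow_mul, ← pow_add, ← pow_add]
    exact hpow _ (by omega)
  have hα1 : 1 - α ≠ 0 := by simpa using hpow 1 one_pos
  have hα2 : 1 - α ^ 2 ≠ 0 := hpow 2 two_pos
  have hα3 : 1 + α ^ 2 ≠ 0 := fun h =>
    hpow 4 four_pos (by linear_combination (1 - α ^ 2) * h)
  have hsum := EvalAt.sum (α := α) (f := summand RatFunc.X a) (g := summand α b)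
    (s := range ((n - 1) / 4 + 1)) fun k _ => by
      have hD : qPoch (α ^ 8) (α ^ 8) k ^ 2 * qPoch (b * α ^ 8) (α ^ 8) k *
          qPoch (α ^ 8 / b) (α ^ 8) k ≠ 0 :=
        mul_ne_zero (mul_ne_zero (pow_ne_zero _ (qPoch_ne_zero fun i _ => h1 i))
          (qPoch_ne_zero fun i _ => h2 i)) (qPoch_ne_zero fun i _ => h3 i)
      exact (((((hX.pow 2).qInt (pow_ne_zero 2 hα0) hα2 _).mul ((hX.qInt hα0 hα1 _).pow 2)).mul
        (((((hX.pow 2).qPoch (hX.pow 8) k).pow 2).mul ((ha.mul (hX.pow 2)).qPoch (hX.pow 8) k)).mul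
          (((hX.pow 2).div ha hb0).qPoch (hX.pow 8) k))).div
        (((((hX.pow 8).qPoch (hX.pow 8) k).pow 2).mul ((ha.mul (hX.pow 8)).qPoch (hX.pow 8) k)).mul
          (((hX.pow 8).div ha hb0).qPoch (hX.pow 8) k)) hD).mul (hX.zpow hα0 _)
  have hclosed : EvalAt α (closedForm RatFunc.X a n) (closedForm α b n) :=
    (((((hX.pow 2).qInt (pow_ne_zero 2 hα0) hα2 n).mul ((hX.pow 4).qPoch (hX.pow 8) _)).div
      ((hX.pow 8).qPoch (hX.pow 8) _) (qPoch_ne_zero fun i _ => h1 i)).mul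
      (hX.zpow hα0 _)).mul
    (EvalAt.one.sub (((EvalAt.one.sub (ha.mul (hX.pow 2))).mul
      (EvalAt.one.sub ((hX.pow 2).div ha hb0))).div
      (((EvalAt.one.sub hX).pow 2).mul (EvalAt.one.add (hX.pow 2)))
      (mul_ne_zero (pow_ne_zero 2 hα1) hα3)))
  have := hsum.sub hclosed
  rwa [sum_summand_eq_closedForm hinj hα0 hn4 hb, sub_self] at this

/-- The congruence at the points where `a = q ^ (2 * n)`. -/
lemma evalAt_sub_zero_of_pow_eq (ha : EvalAt α a b)
    (hinj : Function.Injective fun m : ℕ => α ^ m) {n : ℕ} (hn4 : n % 4 = 1) (hb0 : b ≠ 0)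
    (hb : α ^ (2 * n) = b) :
    EvalAt α (∑ k ∈ range ((n - 1) / 4 + 1), summand RatFunc.X a k -
      closedForm RatFunc.X a n) 0 := by
  simpa only [summand_inv, closedForm_inv] using
    evalAt_sub_zero_of_mul_pow_eq_one (ha.inv hb0) hinj hn4 (by rw [hb, inv_mul_cancel₀ hb0])

/-- The congruence at the points where `q ^ (2 * n) = 1`. -/
lemma evalAt_sub_zero_of_pow_eq_one [CharZero L] (ha : EvalAt α a b)
    (hb : Function.Injective fun m : ℕ => b ^ m) {n : ℕ} (hn4 : n % 4 = 1)
    (hα1 : 1 - α ^ 2 ≠ 0) (hα : α ^ (2 * n) = 1) :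
    EvalAt α (∑ k ∈ range ((n - 1) / 4 + 1), summand RatFunc.X a k -
      closedForm RatFunc.X a n) 0 := by
  have hn0 : n ≠ 0 := by omega
  have hb0 : b ≠ 0 := by
    rintro rfl
    simpa using hb (a₁ := 1) (a₂ := 2) (by simp)
  have hα0 : α ≠ 0 := by
    rintro rfl
    rw [zero_pow (by omega)] at hα
    exact zero_ne_one hα
  have hb1 : ∀ {c : L}, c ^ n = 1 → b * c ≠ 1 := fun {c} hc h => by
    have := congrArg (· ^ n) h
    simp only [mul_pow, hc, one_pow, mul_one] at this
    exact hn0 (hb (by simpa using this))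
  have hpow : ∀ i, (α ^ 8 * (α ^ 8) ^ i) ^ n = 1 := fun i => by
    rw [show (α ^ 8 * (α ^ 8) ^ i) ^ n = (α ^ (2 * n)) ^ (4 + 4 * i) by ring, hα, one_pow]
  have h2 : ∀ i, 1 - b * α ^ 8 * (α ^ 8) ^ i ≠ 0 := fun i h =>
    hb1 (hpow i) (by linear_combination -h)
  have h3 : ∀ i, 1 - α ^ 8 / b * (α ^ 8) ^ i ≠ 0 := fun i h => by
    refine hb1 (c := (α ^ 8 * (α ^ 8) ^ i)⁻¹) (by rw [inv_pow, hpow, inv_one]) ?_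
    rw [div_mul_eq_mul_div, sub_eq_zero, eq_div_iff hb0, one_mul] at h
    rw [← h, mul_inv_cancel₀ hb0]
  have hα2 : 1 + α ^ 2 ≠ 0 := fun h => by
    have h' : α ^ 2 = -1 := by linear_combination h
    rw [pow_mul, h', Odd.neg_one_pow (Nat.odd_iff.2 (by omega))] at hα
    exact hα1 (by rw [h', hα, sub_self])
  have hαn : (α ^ 2) ^ n = 1 := by rw [← pow_mul, hα]
  have hd : orderOf (α ^ 2) ∣ n := orderOf_dvd_of_pow_eq_one hαn
  have hdpos : 0 < orderOf (α ^ 2) := Nat.pos_of_dvd_of_pos hd (by omega)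
  have hr : IsPrimitiveRoot (α ^ 8) (orderOf (α ^ 2)) := by
    have hcop : Nat.Coprime 4 (orderOf (α ^ 2)) := by
      refine Nat.Coprime.coprime_dvd_right hd ?_
      rw [Nat.coprime_iff_gcd_eq_one, Nat.gcd_rec, hn4]
      simp
    have := (IsPrimitiveRoot.orderOf (α ^ 2)).pow_of_coprime 4 hcop
    rwa [← pow_mul] at this
  have hαd : α ^ (2 * orderOf (α ^ 2)) = 1 := by rw [pow_mul, pow_orderOf_eq_one]
  have hN : n = 4 * ((n - 1) / 4) + 1 := by omega
  rw [← sub_self (0 : L)]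
  exact (evalAt_sum_zero_of_rootOfUnity ha hdpos hα0 hα1 hb0 hαd hr hd hN h2 h3).sub
    (evalAt_closedForm_zero_of_rootOfUnity ha hdpos hα0 hα1 hα2 hb0 hαd hr hd hN)

/-- The modulus is separable when `c` is not a root of unity. -/
lemma separable_modulus [CharZero F] {c : F} (hc : Function.Injective fun m : ℕ => c ^ m)
    {n : ℕ} (hn : 0 < n) :
    ((∑ i ∈ range n, (X : F[X]) ^ (2 * i)) * (1 - C c * X ^ (2 * n)) *
      (C c - X ^ (2 * n))).Separable := by
  have hc0 : c ≠ 0 := by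
    rintro rfl
    simpa using hc (a₁ := 1) (a₂ := 2) (by simp)
  have hc1 : c ≠ 1 := fun h => by simpa using hc (a₁ := 1) (a₂ := 0) (by simpa using h)
  have hc2 : c ^ 2 ≠ 1 := fun h => by simpa using hc (a₁ := 2) (a₂ := 0) (by simpa using h)
  have hsep : ∀ {u : F}, u ≠ 0 → (X ^ (2 * n) - C u : F[X]).Separable := fun hu =>
    separable_X_pow_sub_C _ (Nat.cast_ne_zero.2 (by omega)) hu
  have hcop : ∀ {u v : F}, u ≠ v →
      IsCoprime (X ^ (2 * n) - C u : F[X]) (X ^ (2 * n) - C v) := fun {u v} huv => by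
    refine ⟨C (v - u)⁻¹, -C (v - u)⁻¹, ?_⟩
    have : (C (v - u)⁻¹ : F[X]) * C (v - u) = 1 := by
      rw [← C_mul, inv_mul_cancel₀ (sub_ne_zero.2 huv.symm), C_1]
    rw [← this, C_sub]
    ring
  have hall : ((X ^ (2 * n) - C 1 : F[X]) * (X ^ (2 * n) - C c⁻¹) *
      (X ^ (2 * n) - C c)).Separable := by
    refine ((hsep one_ne_zero).mul (hsep (inv_ne_zero hc0)) (hcop ?_)).mul (hsep hc0)
      (IsCoprime.mul_left (hcop hc1.symm) (hcop ?_))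
    · rw [ne_comm, ne_eq, inv_eq_one]; exact hc1
    · intro h
      exact hc2 (by rw [sq]; nth_rw 1 [← h]; exact inv_mul_cancel₀ hc0)
  refine hall.of_dvd ⟨(X ^ 2 - 1) * C c⁻¹, ?_⟩
  have hg : (∑ i ∈ range n, (X : F[X]) ^ (2 * i)) * (X ^ 2 - 1) = X ^ (2 * n) - 1 := by
    simp only [pow_mul]
    exact geom_sum_mul _ _
  have hcc : (C c : F[X]) * C c⁻¹ = 1 := by rw [← C_mul, mul_inv_cancel₀ hc0, C_1]
  rw [C_1]
  linear_combination (-(X ^ (2 * n) - C c) * (X ^ (2 * n) - C c⁻¹)) * hg +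
    (∑ i ∈ range n, X ^ (2 * i)) * (X ^ 2 - 1) * (C c - X ^ (2 * n)) * X ^ (2 * n) * hcc

end Congruence

/-- Parametric generalization of Theorem 2 (Theorem 4, eq. (3.3) of the paper):
congruence modulo `[n]_{q²}(1-aq^{2n})(a-q^{2n})`. -/
theorem stmt18 (n : ℕ) (hn : 0 < n) (hn4 : n % 4 = 1) :
    let q : RatFunc (RatFunc ℚ) := RatFunc.X
    let a : RatFunc (RatFunc ℚ) := RatFunc.C RatFunc.X
    ratCongr2 ((∑ i ∈ Finset.range n, (X : Polynomial (RatFunc ℚ)) ^ (2 * i)) *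
        (1 - C (RatFunc.X : RatFunc ℚ) * X ^ (2 * n)) *
        (C (RatFunc.X : RatFunc ℚ) - X ^ (2 * n)))
      ((∑ k ∈ Finset.range ((n - 1) / 4 + 1),
          qInt (q ^ 2) (8 * (k : ℤ) + 1) * qInt q (8 * (k : ℤ) + 1) ^ 2 *
            (qPoch (q ^ 2) (q ^ 8) k ^ 2 * qPoch (a * q ^ 2) (q ^ 8) k *
              qPoch (q ^ 2 / a) (q ^ 8) k) /
            (qPoch (q ^ 8) (q ^ 8) k ^ 2 * qPoch (a * q ^ 8) (q ^ 8) k *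
              qPoch (q ^ 8 / a) (q ^ 8) k) * q ^ (-4 * (k : ℤ))) -
        qInt (q ^ 2) (n : ℤ) * qPoch (q ^ 4) (q ^ 8) ((n - 1) / 4) /
            qPoch (q ^ 8) (q ^ 8) ((n - 1) / 4) * q ^ (-(((n : ℤ) - 1) / 2)) *
          (1 - (1 - a * q ^ 2) * (1 - q ^ 2 / a) / ((1 - q) ^ 2 * (1 + q ^ 2)))) := by
  intro q a
  set L := AlgebraicClosure (RatFunc ℚ)
  have hinj : Function.Injective fun m : ℕ => (RatFunc.X : RatFunc ℚ) ^ m := fun s t h => by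
    have : (X : ℚ[X]) ^ s = X ^ t := RatFunc.algebraMap_injective ℚ (by simpa using h)
    simpa using congrArg natDegree this
  set b : L := algebraMap (RatFunc ℚ) L RatFunc.X with hb
  have hinjb : Function.Injective fun m : ℕ => b ^ m :=
    fun s t h => hinj ((algebraMap (RatFunc ℚ) L).injective (by simpa using h))
  have hn0 : (n : L) ≠ 0 := Nat.cast_ne_zero.2 hn.ne'
  refine exists_eq_mul_of_evalAt_zero (L := L) (separable_modulus hinj hn) fun α hα => ?_
  change EvalAt α (∑ k ∈ range ((n - 1) / 4 + 1), summand RatFunc.X a k -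
    closedForm RatFunc.X a n) 0
  have ha : EvalAt α a b := EvalAt.C RatFunc.X
  have hpow : ∀ {s t : ℕ}, α ^ s = α ^ t → (α ^ (2 * n)) ^ s = (α ^ (2 * n)) ^ t :=
    fun {s t} h => by rw [← pow_mul, mul_comm, pow_mul, h, ← pow_mul, mul_comm, pow_mul]
  simp only [map_mul, map_sub, map_sum, map_pow, map_one, aeval_X, aeval_C, mul_eq_zero,
    ← hb] at hα
  obtain (hα | hα) | hα := hα
  · refine evalAt_sub_zero_of_pow_eq_one ha hinjb hn4 (fun h => hn0 ?_) ?_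
    · simpa [pow_mul, ← sub_eq_zero.1 h] using hα
    · have := geom_sum_mul (α ^ 2) n
      simp only [← pow_mul] at this
      rw [hα, zero_mul, eq_comm, sub_eq_zero] at this
      exact this
  · have h1 : b * α ^ (2 * n) = 1 := (sub_eq_zero.1 hα).symm
    refine evalAt_sub_zero_of_mul_pow_eq_one ha (fun s t h => hinjb ?_) hn4 h1
    have hne : (α ^ (2 * n)) ^ t ≠ 0 := pow_ne_zero _ (right_ne_zero_of_mul_eq_one h1)
    refine mul_right_cancel₀ hne ?_
    change b ^ s * _ = b ^ t * _
    rw [← mul_pow b _ t, ← hpow h, ← mul_pow, h1, one_pow, one_pow]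
  · have h1 : α ^ (2 * n) = b := (sub_eq_zero.1 hα).symm
    refine evalAt_sub_zero_of_pow_eq ha (fun s t h => hinjb ?_) hn4 ?_ h1
    · simpa only [h1] using hpow h
    · rw [hb, _root_.map_ne_zero]
      exact RatFunc.X_ne_zero
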